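/- arXiv:2102.08869 — 5 statements merged into one kernel-verified Lean document; each statement's English description precedes it below -/
import Mathlib

section
/- Let n ≥ 1, let E = EuclideanSpace ℝ (Fin n), and let v : E → ℝ be differentiable and concave. Let t₀ ≤ T and let α, μ : ℝ → E be differentiable on [t₀, T] and satisfy the gradient-flow equations α'(t) = ∇v(α(t)) and μ'(t) = ∇v(μ(t)) for all t ∈ [t₀, T]. Then for every t ∈ [t₀, T] one has ‖α(t) − μ(t)‖ ≤ ‖α(t₀) − μ(t₀)‖ (the flow of the gradient of a concave function is a contraction). -/
open Set

/-- The first-order upper bound for a differentiable concave function. -/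
theorem ConcaveOn.sub_le_inner_gradient {E : Type*} [NormedAddCommGroup E]
    [InnerProductSpace ℝ E] [CompleteSpace E] {v : E → ℝ} (hconc : ConcaveOn ℝ Set.univ v)
    {x : E} (hv : DifferentiableAt ℝ v x) (y : E) :
    v y - v x ≤ inner ℝ (gradient v x) (y - x) := by
  have hline : ConcaveOn ℝ Set.univ (v ∘ AffineMap.lineMap (k := ℝ) x y) := by
    simpa using hconc.comp_affineMap (AffineMap.lineMap (k := ℝ) x y)
  have hderiv : HasDerivAt (v ∘ AffineMap.lineMap (k := ℝ) x y)
      (inner ℝ (gradient v x) (y - x)) 0 := by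
    have h : HasFDerivAt v (InnerProductSpace.toDual ℝ E (gradient v x))
        (AffineMap.lineMap (k := ℝ) x y 0) := by
      simpa using hv.hasGradientAt.hasFDerivAt
    simpa using h.comp_hasDerivAt (0 : ℝ) AffineMap.hasDerivAt_lineMap
  have hslope := hline.slope_le_of_hasDerivAt (mem_univ 0) (mem_univ 1) one_pos hderiv
  simpa [slope_def_field] using hslope

/-- The gradient of a differentiable concave function is a monotone decreasing operator. -/
theorem ConcaveOn.inner_sub_gradient_sub_nonpos {E : Type*} [NormedAddCommGroup E]
    [InnerProductSpace ℝ E] [CompleteSpace E] {v : E → ℝ} (hconc : ConcaveOn ℝ Set.univ v)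
    {x y : E} (hx : DifferentiableAt ℝ v x) (hy : DifferentiableAt ℝ v y) :
    inner ℝ (x - y) (gradient v x - gradient v y) ≤ 0 := by
  have hxy := hconc.sub_le_inner_gradient hx y
  have hyx := hconc.sub_le_inner_gradient hy x
  rw [← neg_sub x y, inner_neg_right] at hxy
  rw [real_inner_comm, inner_sub_left]
  linarith

/-- The flow of the gradient of a differentiable concave function on
`EuclideanSpace ℝ (Fin n)` is a contraction: two streamlines do not spread apart. -/
theorem gradient_flow_contraction (n : ℕ) (hn : 1 ≤ n)
    (v : EuclideanSpace ℝ (Fin n) → ℝ)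
    (hv : Differentiable ℝ v) (hconc : ConcaveOn ℝ Set.univ v)
    (t₀ T : ℝ) (ht : t₀ ≤ T)
    (α μ : ℝ → EuclideanSpace ℝ (Fin n))
    (hα : ∀ t ∈ Set.Icc t₀ T, HasDerivAt α (gradient v (α t)) t)
    (hμ : ∀ t ∈ Set.Icc t₀ T, HasDerivAt μ (gradient v (μ t)) t) :
    ∀ t ∈ Set.Icc t₀ T, ‖α t - μ t‖ ≤ ‖α t₀ - μ t₀‖ := by
  intro t htT
  have hderiv (s : ℝ) (hs : s ∈ Icc t₀ T) : HasDerivAt (fun s ↦ ‖α s - μ s‖ ^ 2)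
      (2 * inner ℝ (α s - μ s) (gradient v (α s) - gradient v (μ s))) s :=
    ((hα s hs).sub (hμ s hs)).norm_sq
  have hanti : AntitoneOn (fun s ↦ ‖α s - μ s‖ ^ 2) (Icc t₀ T) :=
    antitoneOn_of_hasDerivWithinAt_nonpos (convex_Icc t₀ T)
      (fun s hs ↦ (hderiv s hs).continuousAt.continuousWithinAt)
      (fun s hs ↦ (hderiv s (interior_subset hs)).hasDerivWithinAt)
      (fun s _ ↦ mul_nonpos_of_nonneg_of_nonpos zero_le_two
        (hconc.inner_sub_gradient_sub_nonpos (hv _) (hv _)))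
  exact le_of_sq_le_sq (hanti (left_mem_Icc.2 ht) htT htT.1) (norm_nonneg _)
end

section
/- Let n ≥ 1, let E = EuclideanSpace ℝ (Fin n), and let v : E → ℝ be differentiable and concave. Let t₀ ≤ T and let α, μ : ℝ → E be differentiable on [t₀, T] with α'(t) = ∇v(α(t)) and μ'(t) = ∇v(μ(t)) for all t ∈ [t₀, T]. If α(t₀) = μ(t₀), then α(t) = μ(t) for all t ∈ [t₀, T] (forward uniqueness of streamlines of a concave C¹ function). -/
open Set

/-- A concave function lies below its tangent hyperplanes. -/
theorem ConcaveOn.le_add_inner_gradient {F : Type*} [NormedAddCommGroup F] [InnerProductSpace ℝ F]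
    [CompleteSpace F] {v : F → ℝ} (hconc : ConcaveOn ℝ Set.univ v) {x : F}
    (hv : DifferentiableAt ℝ v x) (y : F) :
    v y ≤ v x + inner ℝ (gradient v x) (y - x) := by
  have hline : HasDerivAt (AffineMap.lineMap x y : ℝ → F) (y - x) 0 :=
    AffineMap.hasDerivAt_lineMap
  have hg : HasDerivAt (v ∘ (AffineMap.lineMap x y : ℝ →ᵃ[ℝ] F))
      (inner ℝ (gradient v x) (y - x)) 0 := by
    have hf : HasFDerivAt v (InnerProductSpace.toDual ℝ F (gradient v x))
        ((AffineMap.lineMap x y : ℝ → F) 0) := by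
      simpa using hv.hasGradientAt.hasFDerivAt
    simpa using hf.comp_hasDerivAt 0 hline
  have hc : ConcaveOn ℝ Set.univ (v ∘ (AffineMap.lineMap x y : ℝ →ᵃ[ℝ] F)) := by
    simpa using hconc.comp_affineMap (AffineMap.lineMap x y : ℝ →ᵃ[ℝ] F)
  have h := hc.slope_le_of_hasDerivAt (mem_univ 0) (mem_univ 1) one_pos hg
  simp only [slope_def_field, Function.comp_apply, AffineMap.lineMap_apply_one,
    AffineMap.lineMap_apply_zero, sub_zero, div_one] at h
  linarith

/-- The gradient of a differentiable concave function is a monotone decreasing operator. -/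
theorem ConcaveOn.inner_gradient_sub_nonpos {F : Type*} [NormedAddCommGroup F]
    [InnerProductSpace ℝ F] [CompleteSpace F] {v : F → ℝ} (hconc : ConcaveOn ℝ Set.univ v) {x y : F}
    (hx : DifferentiableAt ℝ v x) (hy : DifferentiableAt ℝ v y) :
    inner ℝ (x - y) (gradient v x - gradient v y) ≤ 0 := by
  have h₁ := hconc.le_add_inner_gradient hx y
  have h₂ := hconc.le_add_inner_gradient hy x
  rw [real_inner_comm, inner_sub_left]
  rw [← neg_sub x y, inner_neg_right] at h₁
  linarith

/-- Forward uniqueness of streamlines of a differentiable concave function. -/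
theorem gradient_flow_uniqueness (n : ℕ) (hn : 1 ≤ n)
    (v : EuclideanSpace ℝ (Fin n) → ℝ)
    (hv : Differentiable ℝ v) (hconc : ConcaveOn ℝ Set.univ v)
    (t₀ T : ℝ) (ht : t₀ ≤ T)
    (α μ : ℝ → EuclideanSpace ℝ (Fin n))
    (hα : ∀ t ∈ Set.Icc t₀ T, HasDerivAt α (gradient v (α t)) t)
    (hμ : ∀ t ∈ Set.Icc t₀ T, HasDerivAt μ (gradient v (μ t)) t)
    (h0 : α t₀ = μ t₀) :
    ∀ t ∈ Set.Icc t₀ T, α t = μ t := by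
  have hd : ∀ t ∈ Icc t₀ T, HasDerivAt (fun s => ‖α s - μ s‖ ^ 2)
      (2 * inner ℝ (α t - μ t) (gradient v (α t) - gradient v (μ t))) t :=
    fun t h => ((hα t h).sub (hμ t h)).norm_sq
  have hanti : AntitoneOn (fun s => ‖α s - μ s‖ ^ 2) (Icc t₀ T) := by
    refine antitoneOn_of_deriv_nonpos (convex_Icc t₀ T)
      (fun t h => (hd t h).continuousAt.continuousWithinAt)
      (fun t h => (hd t (interior_subset h)).differentiableAt.differentiableWithinAt) ?_
    intro t h
    rw [(hd t (interior_subset h)).deriv]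
    have := hconc.inner_gradient_sub_nonpos (hv (α t)) (hv (μ t))
    linarith
  intro t h
  have hle : ‖α t - μ t‖ ^ 2 ≤ 0 := by
    simpa [h0] using hanti (left_mem_Icc.2 ht) h h.1
  exact sub_eq_zero.1 <| norm_eq_zero.1 <|
    (pow_eq_zero_iff two_ne_zero).1 (le_antisymm hle (sq_nonneg _))
end

section
/- Let n ≥ 1, let E = EuclideanSpace ℝ (Fin n), and let v : E → ℝ be twice continuously differentiable (ContDiff ℝ 2) and concave. Let α : ℝ → E be differentiable on an interval [t₁, t₂] with α'(t) = ∇v(α(t)) for all t ∈ [t₁, t₂]. Then the function t ↦ v(α(t)) is concave on [t₁, t₂], and the speed is non-increasing: ‖∇v(α(s₂))‖ ≤ ‖∇v(α(s₁))‖ whenever t₁ ≤ s₁ ≤ s₂ ≤ t₂. -/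
open Set

section Gradient

variable {F : Type*} [NormedAddCommGroup F] [InnerProductSpace ℝ F] [CompleteSpace F]

theorem ContDiff.differentiable_gradient {v : F → ℝ} (hv : ContDiff ℝ 2 v) :
    Differentiable ℝ (gradient v) := by
  have h : Differentiable ℝ (fderiv ℝ v) :=
    (hv.fderiv_right (m := 1) (by norm_num)).differentiable (by norm_num)
  exact (InnerProductSpace.toDual ℝ F).symm.differentiable.comp h

theorem DifferentiableAt.hasDerivAt_comp_inner_gradient {v : F → ℝ} {γ : ℝ → F} {w : F} {t : ℝ}
    (hv : DifferentiableAt ℝ v (γ t)) (hγ : HasDerivAt γ w t) :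
    HasDerivAt (fun s => v (γ s)) (Inner.inner ℝ (gradient v (γ t)) w) t := by
  have h := hv.hasGradientAt.hasFDerivAt.comp_hasDerivAt t hγ
  simpa [Function.comp_def] using h

theorem ConcaveOn.inner_fderiv_gradient_nonpos {v : F → ℝ} (hconc : ConcaveOn ℝ univ v)
    (hv : ContDiff ℝ 2 v) (x w : F) :
    inner ℝ (fderiv ℝ (gradient v) x w) w ≤ 0 := by
  have hline : ∀ s : ℝ, HasDerivAt (fun s : ℝ => x + s • w) w s := fun s => by
    simpa using ((hasDerivAt_id s).smul_const w).const_add x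
  have hrestr : ConcaveOn ℝ univ (fun s : ℝ => v (x + s • w)) := by
    refine ⟨convex_univ, fun a _ b _ p q hp hq hpq => ?_⟩
    have h := hconc.2 (mem_univ (x + a • w)) (mem_univ (x + b • w)) hp hq hpq
    have hcomb : p • (x + a • w) + q • (x + b • w) = x + (p • a + q • b) • w := by
      rw [← eq_sub_iff_add_eq'] at hpq
      subst hpq
      simp only [smul_eq_mul]
      module
    rwa [hcomb] at h
  have hderiv : ∀ s : ℝ, HasDerivAt (fun s : ℝ => v (x + s • w))
      (inner ℝ (gradient v (x + s • w)) w) s := fun s =>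
    (hv.differentiable (by norm_num) _).hasDerivAt_comp_inner_gradient (hline s)
  have hanti : Antitone (fun s : ℝ => inner ℝ (gradient v (x + s • w)) w) := by
    have h := antitoneOn_univ.1
      (hrestr.antitoneOn_deriv fun s _ => (hderiv s).differentiableAt)
    rwa [show deriv (fun s : ℝ => v (x + s • w)) = _ from funext fun s => (hderiv s).deriv] at h
  have hsecond : HasDerivAt (fun s : ℝ => inner ℝ (gradient v (x + s • w)) w)
      (inner ℝ (fderiv ℝ (gradient v) x w) w) 0 := by
    have hg : HasFDerivAt (gradient v) (fderiv ℝ (gradient v) x) (x + (0 : ℝ) • w) := by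
      simpa using (hv.differentiable_gradient x).hasFDerivAt
    simpa [Function.comp_def] using
      (hg.comp_hasDerivAt (0 : ℝ) (hline 0)).inner ℝ (hasDerivAt_const (0 : ℝ) w)
  rw [← hsecond.deriv]
  exact hanti.deriv_nonpos

end Gradient

/-- Along a streamline of a `C²` concave function, `v ∘ α` is concave and the speed
`‖∇v(α(t))‖` is non-increasing. -/
theorem concave_along_streamline_and_speed_nonincreasing (n : ℕ) (hn : 1 ≤ n)
    (v : EuclideanSpace ℝ (Fin n) → ℝ)
    (hv : ContDiff ℝ 2 v) (hconc : ConcaveOn ℝ Set.univ v)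
    (t₁ t₂ : ℝ) (ht : t₁ ≤ t₂)
    (α : ℝ → EuclideanSpace ℝ (Fin n))
    (hα : ∀ t ∈ Set.Icc t₁ t₂, HasDerivAt α (gradient v (α t)) t) :
    ConcaveOn ℝ (Set.Icc t₁ t₂) (fun t => v (α t)) ∧
    ∀ s₁ s₂ : ℝ, t₁ ≤ s₁ → s₁ ≤ s₂ → s₂ ≤ t₂ →
      ‖gradient v (α s₂)‖ ≤ ‖gradient v (α s₁)‖ := by
  have hfirst : ∀ t ∈ Icc t₁ t₂,
      HasDerivAt (fun t => v (α t)) (‖gradient v (α t)‖ ^ 2) t := fun t h => by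
    simpa only [real_inner_self_eq_norm_sq] using
      (hv.differentiable (by norm_num) _).hasDerivAt_comp_inner_gradient (hα t h)
  have hsecond : ∀ t ∈ Icc t₁ t₂, HasDerivAt (fun t => ‖gradient v (α t)‖ ^ 2)
      (2 * inner ℝ (gradient v (α t))
        (fderiv ℝ (gradient v) (α t) (gradient v (α t)))) t := fun t h =>
    ((hv.differentiable_gradient (α t)).hasFDerivAt.comp_hasDerivAt t (hα t h)).norm_sq
  have hanti : AntitoneOn (fun t => ‖gradient v (α t)‖ ^ 2) (Icc t₁ t₂) := by
    refine antitoneOn_of_deriv_nonpos (convex_Icc t₁ t₂)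
      (fun t h => (hsecond t h).continuousAt.continuousWithinAt)
      (fun t h => (hsecond t (interior_subset h)).differentiableAt.differentiableWithinAt)
      fun t h => ?_
    rw [(hsecond t (interior_subset h)).deriv, real_inner_comm]
    linarith [hconc.inner_fderiv_gradient_nonpos hv (α t) (gradient v (α t))]
  refine ⟨?_, fun s₁ s₂ h₁ h₁₂ h₂ => ?_⟩
  · refine AntitoneOn.concaveOn_of_deriv (convex_Icc t₁ t₂)
      (fun t h => (hfirst t h).continuousAt.continuousWithinAt)
      (fun t h => (hfirst t (interior_subset h)).differentiableAt.differentiableWithinAt) ?_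
    exact (hanti.mono interior_subset).congr fun t h =>
      (hfirst t (interior_subset h)).deriv.symm
  · exact (sq_le_sq₀ (norm_nonneg _) (norm_nonneg _)).1
      (hanti ⟨h₁, h₁₂.trans h₂⟩ ⟨h₁.trans h₁₂, h₂⟩ h₁₂)
end

section
/- Let n ≥ 1, let E = EuclideanSpace ℝ (Fin n), let v : E → ℝ be continuously differentiable, and let α : ℝ → E be differentiable on [t₁, t₂] (with t₁ ≤ t₂) with α'(t) = ∇v(α(t)) for all t ∈ [t₁, t₂]. Then the arc length of α over [t₁, t₂] satisfies ∫_{t₁}^{t₂} ‖∇v(α(t))‖ dt ≤ √( (t₂ − t₁) · ( v(α(t₂)) − v(α(t₁)) ) ). -/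
open Set

/-- The Cauchy–Schwarz inequality for `f` and the constant function `1` on `[a, b]`. -/
theorem sq_intervalIntegral_le_mul_integral_sq {f : ℝ → ℝ} {a b : ℝ} (hab : a ≤ b)
    (hf : ContinuousOn f (Set.uIcc a b)) :
    (∫ t in a..b, f t) ^ 2 ≤ (b - a) * ∫ t in a..b, f t ^ 2 := by
  rcases hab.eq_or_lt with rfl | hlt
  · simp
  have hL : 0 < b - a := sub_pos.2 hlt
  set I := ∫ t in a..b, f t with hI
  set c := I / (b - a) with hc
  have hcI : c * (b - a) = I := div_mul_cancel₀ _ hL.ne'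
  have hfi : IntervalIntegrable f MeasureTheory.volume a b := hf.intervalIntegrable
  have hle : ∫ t in a..b, (2 * c * f t - c ^ 2) ≤ ∫ t in a..b, f t ^ 2 := by
    refine intervalIntegral.integral_mono_on hab ((hfi.const_mul _).sub (by simp))
      (hf.pow 2).intervalIntegrable fun t _ => ?_
    nlinarith [sq_nonneg (f t - c)]
  rw [intervalIntegral.integral_sub (hfi.const_mul _) (by simp),
    intervalIntegral.integral_const_mul, intervalIntegral.integral_const, smul_eq_mul, ← hI] at hle
  calc I ^ 2 = (b - a) * (2 * c * I - (b - a) * c ^ 2) := by rw [← hcI]; ring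
    _ ≤ _ := mul_le_mul_of_nonneg_left hle hL.le

theorem ContDiff.continuous_gradient {F : Type*} [NormedAddCommGroup F] [InnerProductSpace ℝ F]
    [CompleteSpace F] {v : F → ℝ} (hv : ContDiff ℝ 1 v) : Continuous (gradient v) :=
  (InnerProductSpace.toDual ℝ F).symm.continuous.comp (hv.continuous_fderiv one_ne_zero)

theorem HasGradientAt.comp_hasDerivAt_self {F : Type*} [NormedAddCommGroup F]
    [InnerProductSpace ℝ F] [CompleteSpace F] {v : F → ℝ} {α : ℝ → F} {g : F} {t : ℝ}
    (hv : HasGradientAt v g (α t)) (hα : HasDerivAt α g t) :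
    HasDerivAt (fun s => v (α s)) (‖g‖ ^ 2) t := by
  have h := hv.hasFDerivAt.comp_hasDerivAt t hα
  rw [InnerProductSpace.toDual_apply_apply, real_inner_self_eq_norm_sq] at h
  exact h

/-- The arc length of a streamline of a `C¹` function over `[t₁, t₂]` is at most
`√((t₂ − t₁)·(v(α(t₂)) − v(α(t₁))))` (Cauchy–Schwarz along the streamline). -/
theorem arclength_bound_along_streamline (n : ℕ) (hn : 1 ≤ n)
    (v : EuclideanSpace ℝ (Fin n) → ℝ)
    (hv : ContDiff ℝ 1 v)
    (t₁ t₂ : ℝ) (ht : t₁ ≤ t₂)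
    (α : ℝ → EuclideanSpace ℝ (Fin n))
    (hα : ∀ t ∈ Set.Icc t₁ t₂, HasDerivAt α (gradient v (α t)) t) :
    (∫ t in t₁..t₂, ‖gradient v (α t)‖) ≤
      Real.sqrt ((t₂ - t₁) * (v (α t₂) - v (α t₁))) := by
  have hcont : ContinuousOn (fun t => ‖gradient v (α t)‖) (Set.uIcc t₁ t₂) := by
    rw [Set.uIcc_of_le ht]
    exact (hv.continuous_gradient.comp_continuousOn
      fun t h => (hα t h).continuousAt.continuousWithinAt).norm
  have hint : ∫ t in t₁..t₂, ‖gradient v (α t)‖ ^ 2 = v (α t₂) - v (α t₁) := by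
    refine intervalIntegral.integral_eq_sub_of_hasDerivAt (f := fun t => v (α t)) (fun t h => ?_)
      (hcont.pow 2).intervalIntegrable
    rw [Set.uIcc_of_le ht] at h
    exact ((hv.differentiable one_ne_zero) (α t)).hasGradientAt.comp_hasDerivAt_self (hα t h)
  rw [← hint]
  exact Real.le_sqrt_of_sq_le (sq_intervalIntegral_le_mul_integral_sq ht hcont)
end

section
/- Let n ≥ 1, let E = EuclideanSpace ℝ (Fin n), let u : E → ℝ be continuously differentiable, let T > 0 and c > 0, and let β : ℝ → E be differentiable on [0, T] with β'(t) = ∇u(β(t)) and ‖∇u(β(t))‖ = c for all t ∈ [0, T]. Suppose moreover that ‖∇u(x)‖ ≤ c for every point x on the closed segment from a := β(0) to b := β(T). Then the arc length of β equals the chord length, ∫₀^T ‖β'(t)‖ dt = ‖b − a‖, and consequently the streamline arc is a straight line segment: β(t) ∈ segment ℝ a b for every t ∈ [0, T]. -/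
open Set

/-- Along a gradient flow line of constant speed `c`, the potential grows at rate `c ^ 2`. -/
theorem sub_eq_of_hasDerivAt_gradient_of_norm_eq {F : Type*} [NormedAddCommGroup F]
    [InnerProductSpace ℝ F] [CompleteSpace F] {u : F → ℝ} (hu : Differentiable ℝ u)
    {β : ℝ → F} {a b c : ℝ} (hab : a ≤ b)
    (hβ : ∀ t ∈ Icc a b, HasDerivAt β (gradient u (β t)) t)
    (hspeed : ∀ t ∈ Icc a b, ‖gradient u (β t)‖ = c) :
    u (β b) - u (β a) = c ^ 2 * (b - a) := by
  have hderiv : ∀ t ∈ Icc a b, HasDerivAt (fun s => u (β s) - c ^ 2 * s) 0 t := by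
    intro t ht
    have h := ((hu (β t)).hasGradientAt.hasFDerivAt.comp_hasDerivAt t (hβ t ht)).sub
      ((hasDerivAt_id t).const_mul (c ^ 2))
    rw [InnerProductSpace.toDual_apply_apply, real_inner_self_eq_norm_sq, hspeed t ht, mul_one,
      sub_self] at h
    exact h
  have h := constant_of_has_deriv_right_zero
    (fun t ht => (hderiv t ht).continuousAt.continuousWithinAt)
    (fun t ht => (hderiv t (Ico_subset_Icc_self ht)).hasDerivWithinAt) b (right_mem_Icc.2 hab)
  linarith

/-- A differentiable function whose gradient is bounded by `c` on a segment varies by at most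
`c` times the length of the segment. -/
theorem norm_sub_le_of_norm_gradient_le_segment {F : Type*} [NormedAddCommGroup F]
    [InnerProductSpace ℝ F] [CompleteSpace F] {u : F → ℝ} (hu : Differentiable ℝ u)
    {x y : F} {c : ℝ} (h : ∀ z ∈ segment ℝ x y, ‖gradient u z‖ ≤ c) :
    ‖u y - u x‖ ≤ c * ‖y - x‖ :=
  (convex_segment x y).norm_image_sub_le_of_norm_hasFDerivWithin_le
    (fun z _ => (hu z).hasGradientAt.hasFDerivAt.hasFDerivWithinAt)
    (fun z hz => (LinearIsometryEquiv.norm_map _ _).trans_le (h z hz))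
    (left_mem_segment ℝ x y) (right_mem_segment ℝ x y)

/-- A constant-speed streamline whose speed dominates `‖∇u‖` on the chord joining its
endpoints has arc length equal to the chord length, and is therefore a straight
line segment. -/
theorem constant_speed_streamline_is_straight (n : ℕ) (hn : 1 ≤ n)
    (u : EuclideanSpace ℝ (Fin n) → ℝ)
    (hu : ContDiff ℝ 1 u)
    (T c : ℝ) (hT : 0 < T) (hc : 0 < c)
    (β : ℝ → EuclideanSpace ℝ (Fin n))
    (hβ : ∀ t ∈ Set.Icc (0 : ℝ) T, HasDerivAt β (gradient u (β t)) t)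
    (hspeed : ∀ t ∈ Set.Icc (0 : ℝ) T, ‖gradient u (β t)‖ = c)
    (hchord : ∀ x ∈ segment ℝ (β 0) (β T), ‖gradient u x‖ ≤ c) :
    (∫ t in (0 : ℝ)..T, ‖gradient u (β t)‖) = ‖β T - β 0‖ ∧
    ∀ t ∈ Set.Icc (0 : ℝ) T, β t ∈ segment ℝ (β 0) (β T) := by
  have hdiff : Differentiable ℝ u := hu.differentiable (by norm_num)
  have hlip : ∀ s ∈ Icc 0 T, ∀ t ∈ Icc 0 T, s ≤ t → dist (β s) (β t) ≤ c * (t - s) := by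
    intro s hs t ht hst
    have h := (convex_Icc 0 T).norm_image_sub_le_of_norm_hasDerivWithin_le
      (fun r hr => (hβ r hr).hasDerivWithinAt) (fun r hr => (hspeed r hr).le) hs ht
    rwa [Real.norm_of_nonneg (sub_nonneg.2 hst), ← dist_eq_norm, dist_comm] at h
  have h0 : (0 : ℝ) ∈ Icc 0 T := left_mem_Icc.2 hT.le
  have hT' : T ∈ Icc 0 T := right_mem_Icc.2 hT.le
  have hlower : c * T ≤ dist (β 0) (β T) := by
    have h₁ := sub_eq_of_hasDerivAt_gradient_of_norm_eq hdiff hT.le hβ hspeed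
    have h₂ := (le_abs_self _).trans (norm_sub_le_of_norm_gradient_le_segment hdiff hchord)
    rw [dist_comm, dist_eq_norm]
    exact le_of_mul_le_mul_left (by linarith) hc
  constructor
  · have hint : (∫ t in (0 : ℝ)..T, ‖gradient u (β t)‖) = ∫ _ in (0 : ℝ)..T, c :=
      intervalIntegral.integral_congr fun t ht => hspeed t (by rwa [uIcc_of_le hT.le] at ht)
    have hupper := hlip 0 h0 T hT' hT.le
    rw [hint, intervalIntegral.integral_const, smul_eq_mul, ← dist_eq_norm, dist_comm]
    linarith
  · intro t ht
    rw [mem_segment_iff_wbtw, ← dist_add_dist_eq_iff]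
    have h₁ := hlip 0 h0 t ht ht.1
    have h₂ := hlip t ht T hT' ht.2
    exact le_antisymm (by linarith) (dist_triangle _ _ _)
end
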